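/- Let 1 ≤ m ≤ n be integers and let λ = (λ_1,…,λ_n) ∈ Γ_m with λ_1 ≥ λ_2 ≥ ⋯ ≥ λ_n. Then λ_1·σ_{m−1}(λ|1) ≥ (m/n)·σ_m(λ). -/

import Mathlib

/-- The `m`-th elementary symmetric function of `λ = (λ_1, …, λ_n) ∈ ℝⁿ`. -/
def esymm (n m : ℕ) (lam : Fin n → ℝ) : ℝ :=
  ∑ s ∈ (Finset.univ : Finset (Fin n)).powersetCard m, ∏ i ∈ s, lam i

/-- The Gårding cone `Γ_m = {λ ∈ ℝⁿ : σ_j(λ) > 0 for all 1 ≤ j ≤ m}`. -/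
def GardingCone (n m : ℕ) : Set (Fin n → ℝ) :=
  {lam | ∀ j : ℕ, 1 ≤ j → j ≤ m → 0 < esymm n j lam}

open Polynomial in
/-- Laguerre's inequality `p * p'' ≤ p'²` for a polynomial with only real roots. -/
theorem Polynomial.Splits.eval_mul_eval_derivative_derivative_le {p : ℝ[X]} (hp : p.Splits)
    (x : ℝ) :
    p.eval x * (derivative (derivative p)).eval x ≤ (derivative p).eval x ^ 2 := by
  induction hp using Submonoid.closure_induction with
  | mem q hq => rcases hq with ⟨a, rfl⟩ | ⟨a, rfl⟩ <;> simp
  | one => simp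
  | mul f g _ _ hf hg =>
    simp only [derivative_mul, derivative_add, eval_add, eval_mul]
    nlinarith [mul_le_mul_of_nonneg_left hf (sq_nonneg (g.eval x)),
      mul_le_mul_of_nonneg_left hg (sq_nonneg (f.eval x))]

open Polynomial in
/-- Rolle's theorem: the derivative of a polynomial with only real roots has only real roots. -/
theorem Polynomial.Splits.derivative_of_real {p : ℝ[X]} (hp : p.Splits) :
    (derivative p).Splits := by
  refine splits_iff_card_roots.mpr (le_antisymm (card_roots' _) ?_)
  have h₁ := card_roots_le_derivative p
  have h₂ := hp.natDegree_eq_card_roots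
  have h₃ := natDegree_derivative_le p
  omega

open Polynomial in
/-- A form of Newton's inequality for the coefficients of a polynomial with only real roots. -/
theorem Polynomial.Splits.coeff_mul_coeff_le_sq {p : ℝ[X]} (hp : p.Splits) (k : ℕ) :
    (k + 2) * (p.coeff k * p.coeff (k + 2)) ≤ (k + 1) * p.coeff (k + 1) ^ 2 := by
  induction k generalizing p with
  | zero =>
    have h := hp.eval_mul_eval_derivative_derivative_le 0
    simp only [← coeff_zero_eq_eval_zero, coeff_derivative] at h
    norm_num at h ⊢
    linarith
  | succ k ih =>
    have h := ih hp.derivative_of_real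
    simp only [coeff_derivative] at h
    push_cast at h ⊢
    have hk : (0 : ℝ) < (k + 1) * (k + 2) := by positivity
    refine le_of_mul_le_mul_left ?_ hk
    ring_nf at h ⊢
    linarith

open Polynomial in
theorem Polynomial.coeff_succ_one_add_C_mul_X_mul (q : ℝ[X]) (a : ℝ) (k : ℕ) :
    ((1 + C a * X) * q).coeff (k + 1) = a * q.coeff k + q.coeff (k + 1) := by
  rw [add_mul, one_mul, coeff_add, mul_assoc, coeff_C_mul, coeff_X_mul, add_comm]

open Polynomial in
/-- Removing one linear factor from a polynomial with only real roots costs at most one degree of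
positivity of its coefficients. -/
theorem Polynomial.Splits.coeff_pos_of_one_add_C_mul_X_mul {q : ℝ[X]} (hq : q.Splits)
    (hq0 : 0 < q.coeff 0) {a : ℝ} {m : ℕ}
    (h : ∀ j ≤ m + 1, 0 < ((1 + C a * X) * q).coeff j) {j : ℕ} (hj : j ≤ m) :
    0 < q.coeff j := by
  induction j with
  | zero => exact hq0
  | succ k ih =>
    have hk := ih (by omega)
    have h₁ := h (k + 1) (by omega)
    have h₂ := h (k + 2) (by omega)
    rw [coeff_succ_one_add_C_mul_X_mul] at h₁ h₂
    have hN := hq.coeff_mul_coeff_le_sq k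
    by_contra! hneg
    have h₃ := mul_le_mul_of_nonneg_left h₁.le (neg_nonneg.mpr hneg)
    have h₄ := mul_pos hk h₂
    have h₅ : q.coeff (k + 1) ^ 2 < q.coeff k * q.coeff (k + 2) := by nlinarith
    have h₆ : (0 : ℝ) ≤ k := k.cast_nonneg
    nlinarith [mul_le_mul_of_nonneg_left h₅.le h₆, sq_nonneg (q.coeff (k + 1))]

open Polynomial in
theorem esymm_eq_coeff_prod (n m : ℕ) (lam : Fin n → ℝ) :
    esymm n m lam = (∏ i, (1 + C (lam i) * X)).coeff m := by
  simp only [Finset.prod_one_add, finsetSum_coeff, Finset.prod_mul_distrib, Finset.prod_const,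
    ← map_prod, coeff_C_mul, coeff_X_pow, mul_ite, mul_one, mul_zero]
  rw [← Finset.sum_filter, esymm, Finset.powersetCard_eq_filter]
  simp only [eq_comm]

open Polynomial in
theorem esymm_update_zero_eq_coeff_prod (n m : ℕ) (lam : Fin n → ℝ) (i : Fin n) :
    esymm n m (Function.update lam i 0) =
      (∏ j ∈ Finset.univ.erase i, (1 + C (lam j) * X)).coeff m := by
  rw [esymm_eq_coeff_prod, ← Finset.mul_prod_erase _ _ (Finset.mem_univ i)]
  simp only [Function.update_self, map_zero, zero_mul, add_zero, one_mul]
  congr 1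
  refine Finset.prod_congr rfl fun j hj => ?_
  rw [Function.update_of_ne (Finset.ne_of_mem_erase hj)]

open Polynomial in
theorem splits_prod_one_add_C_mul_X {ι : Type*} (s : Finset ι) (lam : ι → ℝ) :
    (∏ i ∈ s, (1 + C (lam i) * X)).Splits :=
  .prod fun i _ => .of_natDegree_le_one (by compute_degree)

open Polynomial in
theorem coeff_zero_prod_one_add_C_mul_X {ι : Type*} (s : Finset ι) (lam : ι → ℝ) :
    (∏ i ∈ s, (1 + C (lam i) * X)).coeff 0 = 1 := by
  simp [coeff_zero_prod]

open Polynomial in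
/-- Euler's identity for elementary symmetric functions. -/
theorem sum_mul_coeff_prod_erase {ι : Type*} [DecidableEq ι] (s : Finset ι) (lam : ι → ℝ) (k : ℕ) :
    ∑ i ∈ s, lam i * (∏ j ∈ s.erase i, (1 + C (lam j) * X)).coeff k =
      (k + 1) * (∏ j ∈ s, (1 + C (lam j) * X)).coeff (k + 1) := by
  rw [mul_comm, ← coeff_derivative, derivative_prod_finset, finsetSum_coeff]
  refine Finset.sum_congr rfl fun i _ => ?_
  rw [derivative_add, derivative_one, zero_add, derivative_C_mul_X, coeff_mul_C, mul_comm]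

open Polynomial in
/-- For `λ ∈ Γ_m` with `λ_1 ≥ λ_2 ≥ ⋯ ≥ λ_n`, one has
`λ_1 · σ_{m-1}(λ|1) ≥ (m/n) · σ_m(λ)`. -/
theorem lam_one_mul_esymm_update_ge (n m : ℕ) (hm : 1 ≤ m) (hmn : m ≤ n)
    (lam : Fin n → ℝ) (hlam : lam ∈ GardingCone n m)
    (hsorted : ∀ i j : Fin n, i ≤ j → lam j ≤ lam i) :
    (m : ℝ) / (n : ℝ) * esymm n m lam ≤
      lam (⟨0, by omega⟩ : Fin n) *
        esymm n (m - 1) (Function.update lam (⟨0, by omega⟩ : Fin n) 0) := by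
  obtain ⟨k, rfl⟩ : ∃ k, m = k + 1 := ⟨m - 1, by omega⟩
  have hn : (0 : ℝ) < n := by exact_mod_cast (by omega : 0 < n)
  have hz (i : Fin n) : lam i ≤ lam ⟨0, by omega⟩ := hsorted _ _ (Nat.zero_le _)
  generalize (⟨0, by omega⟩ : Fin n) = z at hz ⊢
  have hpos : ∀ j ≤ k + 1, 0 < (∏ i, (1 + C (lam i) * X)).coeff j := by
    intro j hj
    rcases Nat.eq_zero_or_pos j with rfl | hj0
    · rw [coeff_zero_prod_one_add_C_mul_X]
      exact one_pos
    · rw [← esymm_eq_coeff_prod]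
      exact hlam j hj0 hj
  rw [esymm_update_zero_eq_coeff_prod, esymm_eq_coeff_prod, Nat.add_sub_cancel]
  have hsum := sum_mul_coeff_prod_erase Finset.univ lam k
  have hσ := hpos (k + 1) le_rfl
  have hfac := Finset.mul_prod_erase Finset.univ (fun i => 1 + C (lam i) * X) (Finset.mem_univ z)
  rw [← hfac] at hpos
  have hrec := coeff_succ_one_add_C_mul_X_mul
    (∏ j ∈ Finset.univ.erase z, (1 + C (lam j) * X)) (lam z) k
  rw [hfac] at hrec
  have hcoeff (j : ℕ) (hj : j ≤ k) :=
    (splits_prod_one_add_C_mul_X (Finset.univ.erase z) lam).coeff_pos_of_one_add_C_mul_X_mul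
      (by rw [coeff_zero_prod_one_add_C_mul_X]; exact one_pos) hpos hj
  rcases le_or_gt ((∏ j ∈ Finset.univ.erase z, (1 + C (lam j) * X)).coeff (k + 1)) 0
    with hle | hgt
  · have hmn' : ((k + 1 : ℕ) : ℝ) / n ≤ 1 := (div_le_one hn).mpr (by exact_mod_cast hmn)
    nlinarith
  · have hterm : ∀ i ∈ (Finset.univ : Finset (Fin n)),
        lam i * (∏ j ∈ Finset.univ.erase i, (1 + C (lam j) * X)).coeff k ≤
          lam z * (∏ j ∈ Finset.univ.erase z, (1 + C (lam j) * X)).coeff k := by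
      intro i _
      rcases eq_or_ne i z with rfl | hiz
      · exact le_rfl
      have hfz := Finset.mul_prod_erase (Finset.univ.erase z) (fun i => 1 + C (lam i) * X)
        (Finset.mem_erase.mpr ⟨hiz, Finset.mem_univ i⟩)
      have hfi := Finset.mul_prod_erase (Finset.univ.erase i) (fun i => 1 + C (lam i) * X)
        (Finset.mem_erase.mpr ⟨hiz.symm, Finset.mem_univ z⟩)
      rw [Finset.erase_right_comm] at hfi
      have hq : 0 < (∏ j ∈ (Finset.univ.erase z).erase i, (1 + C (lam j) * X)).coeff k := by
        refine (splits_prod_one_add_C_mul_X _ lam).coeff_pos_of_one_add_C_mul_X_mul (a := lam i)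
          (by rw [coeff_zero_prod_one_add_C_mul_X]; exact one_pos) (fun j hj => ?_) le_rfl
        rw [hfz]
        rcases Nat.le_succ_iff.mp hj with hj | rfl
        · exact hcoeff j hj
        · exact hgt
      rw [← hfz, ← hfi, ← coeff_C_mul, ← coeff_C_mul, ← sub_nonneg, ← coeff_sub]
      generalize ∏ j ∈ (Finset.univ.erase z).erase i, (1 + C (lam j) * X) = q at hq
      have hdiff : C (lam z) * ((1 + C (lam i) * X) * q) - C (lam i) * ((1 + C (lam z) * X) * q) =
          C (lam z - lam i) * q := by
        rw [C_sub]
        ring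
      rw [hdiff, coeff_C_mul]
      exact mul_nonneg (sub_nonneg.mpr (hz i)) hq.le
    have hbound := Finset.sum_le_card_nsmul _ _ _ hterm
    rw [hsum, Finset.card_univ, Fintype.card_fin, nsmul_eq_mul] at hbound
    rw [div_mul_eq_mul_div, div_le_iff₀ hn, mul_comm _ (n : ℝ)]
    push_cast
    exact hbound
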